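/- Any two distinct totals have exactly one syntheme in common: if T₁ and T₂ are distinct totals (five-element sets of pairwise block-disjoint synthemes covering all 15 duads of Fin 6), then T₁ ∩ T₂ contains exactly one syntheme. -/

import Mathlib

/-- A syntheme: a partition of `Fin 6` into three pairwise disjoint 2-element blocks
(duads) whose union is all of `Fin 6`. -/
def IsSyntheme (S : Finset (Finset (Fin 6))) : Prop :=
  S.card = 3 ∧ (∀ b ∈ S, b.card = 2) ∧
    (∀ b₁ ∈ S, ∀ b₂ ∈ S, b₁ ≠ b₂ → b₁ ∩ b₂ = ∅) ∧
    S.biUnion id = Finset.univ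

/-- A total: a set of five synthemes such that every duad (2-element subset of `Fin 6`)
occurs as a block of exactly one of them; equivalently, a one-factorization of the
complete graph on six vertices. -/
def IsTotalFamily (T : Finset (Finset (Finset (Fin 6)))) : Prop :=
  T.card = 5 ∧ (∀ S ∈ T, IsSyntheme S) ∧
    ∀ D : Finset (Fin 6), D.card = 2 → (T.filter fun S => D ∈ S).card = 1

/-- The four points of `Fin 6` outside `{0, i + 1}` are `(i + 1).succ` and
`remainingPoint i j` for `j : Fin 3`. -/
def remainingPoint (i : Fin 5) (j : Fin 3) : Fin 6 :=
  (i + 2 + j.castLE (by decide)).succ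

/-- The three synthemes through the duad `{0, i + 1}`, indexed by the partner of
`(i + 1).succ`. -/
def synthemeThrough (i : Fin 5) (k : Fin 3) : Finset (Finset (Fin 6)) :=
  {{0, i.succ}, {(i + 1).succ, remainingPoint i k},
    {remainingPoint i (k + 1), remainingPoint i (k + 2)}}

/-- The condition on the indices of one syntheme through each duad `{0, i + 1}` for these
synthemes to be pairwise disjoint. -/
def IsTotalIndex (k : Fin 5 → Fin 3) : Prop :=
  ∀ i j, i < j → k i + k j ≠ if j = i + 1 ∨ i = j + 1 then 2 else 0

instance : DecidablePred IsTotalIndex := fun k =>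
  inferInstanceAs (Decidable (∀ i j, i < j → k i + k j ≠ if j = i + 1 ∨ i = j + 1 then 2 else 0))

theorem disjoint_synthemeThrough_iff : ∀ i j, i < j → ∀ k l,
    (Disjoint (synthemeThrough i k) (synthemeThrough j l) ↔
      k + l ≠ if j = i + 1 ∨ i = j + 1 then 2 else 0) := by
  decide +kernel

theorem exists_eq_pair_of_disjoint : ∀ i : Fin 5,
    ∀ b ∈ (Finset.univ : Finset (Fin 6)).powersetCard 2, (i + 1).succ ∈ b →
      {0, i.succ} ∩ b = ∅ → ∃ k, b = {(i + 1).succ, remainingPoint i k} := by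
  decide +kernel

theorem eq_pair_of_disjoint : ∀ (i : Fin 5) (k : Fin 3),
    ∀ c ∈ (Finset.univ : Finset (Fin 6)).powersetCard 2, remainingPoint i (k + 1) ∈ c →
      {0, i.succ} ∩ c = ∅ → {(i + 1).succ, remainingPoint i k} ∩ c = ∅ →
        c = {remainingPoint i (k + 1), remainingPoint i (k + 2)} := by
  decide +kernel

theorem card_synthemeThrough : ∀ i k, (synthemeThrough i k).card = 3 := by
  decide +kernel

theorem succ_notMem_pair : ∀ i : Fin 5, (i + 1).succ ∉ ({0, i.succ} : Finset (Fin 6)) := by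
  decide

theorem remainingPoint_notMem_pairs : ∀ (i : Fin 5) (k : Fin 3),
    remainingPoint i (k + 1) ∉ ({0, i.succ} : Finset (Fin 6)) ∧
      remainingPoint i (k + 1) ∉ ({(i + 1).succ, remainingPoint i k} : Finset (Fin 6)) := by
  decide +kernel

namespace IsSyntheme

variable {S : Finset (Finset (Fin 6))}

theorem exists_mem (hS : IsSyntheme S) (x : Fin 6) : ∃ b ∈ S, x ∈ b := by
  have hx : x ∈ S.biUnion id := hS.2.2.2 ▸ Finset.mem_univ x
  exact Finset.mem_biUnion.1 hx

theorem mem_powersetCard (hS : IsSyntheme S) {b : Finset (Fin 6)} (hb : b ∈ S) :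
    b ∈ (Finset.univ : Finset (Fin 6)).powersetCard 2 :=
  Finset.mem_powersetCard.2 ⟨b.subset_univ, hS.2.1 b hb⟩

theorem inter_eq_empty (hS : IsSyntheme S) {b c : Finset (Fin 6)} (hb : b ∈ S) (hc : c ∈ S)
    {x : Fin 6} (hxb : x ∉ b) (hxc : x ∈ c) : b ∩ c = ∅ :=
  hS.2.2.1 b hb c hc fun h => hxb (h ▸ hxc)

theorem exists_eq_synthemeThrough (hS : IsSyntheme S) {i : Fin 5} (hi : {0, i.succ} ∈ S) :
    ∃ k, S = synthemeThrough i k := by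
  obtain ⟨b, hb, hxb⟩ := hS.exists_mem (i + 1).succ
  obtain ⟨k, rfl⟩ := exists_eq_pair_of_disjoint i b (hS.mem_powersetCard hb) hxb
    (hS.inter_eq_empty hi hb (succ_notMem_pair i) hxb)
  obtain ⟨c, hc, hxc⟩ := hS.exists_mem (remainingPoint i (k + 1))
  obtain ⟨hx₁, hx₂⟩ := remainingPoint_notMem_pairs i k
  obtain rfl := eq_pair_of_disjoint i k c (hS.mem_powersetCard hc) hxc
    (hS.inter_eq_empty hi hc hx₁ hxc) (hS.inter_eq_empty hb hc hx₂ hxc)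
  refine ⟨k, (Finset.eq_of_subset_of_card_le ?_ ?_).symm⟩
  · simp [synthemeThrough, Finset.insert_subset_iff, hi, hb, hc]
  · rw [card_synthemeThrough, hS.1]

end IsSyntheme

theorem IsTotalFamily.eq_of_mem {T : Finset (Finset (Finset (Fin 6)))} (hT : IsTotalFamily T)
    {S S' : Finset (Finset (Fin 6))} (hS : S ∈ T) (hS' : S' ∈ T) {D : Finset (Fin 6)}
    (hD : D ∈ S) (hD' : D ∈ S') : S = S' :=
  Finset.card_le_one.1 (hT.2.2 D ((hT.2.1 S hS).2.1 D hD)).le S (Finset.mem_filter.2 ⟨hS, hD⟩) S'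
    (Finset.mem_filter.2 ⟨hS', hD'⟩)

theorem synthemeThrough_inj : ∀ i k j l,
    synthemeThrough i k = synthemeThrough j l ↔ i = j ∧ k = l := by
  decide +kernel

theorem IsTotalFamily.exists_index {T : Finset (Finset (Finset (Fin 6)))}
    (hT : IsTotalFamily T) :
    ∃ k, IsTotalIndex k ∧ Finset.univ.image (fun i => synthemeThrough i (k i)) = T := by
  have hex (i : Fin 5) : ∃ k, synthemeThrough i k ∈ T := by
    have hcard := hT.2.2 {0, i.succ} (Finset.card_pair (Fin.succ_ne_zero i).symm)
    obtain ⟨S, hS⟩ := Finset.card_pos.1 (hcard ▸ Nat.one_pos)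
    obtain ⟨hST, hiS⟩ := Finset.mem_filter.1 hS
    obtain ⟨k, rfl⟩ := (hT.2.1 S hST).exists_eq_synthemeThrough hiS
    exact ⟨k, hST⟩
  choose k hk using hex
  refine ⟨k, fun i j hij => (disjoint_synthemeThrough_iff i j hij _ _).1 <|
    Finset.disjoint_left.2 fun D hi hj =>
      hij.ne ((synthemeThrough_inj ..).1 (hT.eq_of_mem (hk i) (hk j) hi hj)).1, ?_⟩
  refine Finset.eq_of_subset_of_card_le (Finset.image_subset_iff.2 fun i _ => hk i) ?_
  rw [Finset.card_image_of_injective _ fun i j hij => ((synthemeThrough_inj ..).1 hij).1, hT.1,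
    Finset.card_univ, Fintype.card_fin]

theorem card_inter_image_synthemeThrough (k l : Fin 5 → Fin 3) :
    (Finset.univ.image (fun i => synthemeThrough i (k i)) ∩
      Finset.univ.image (fun i => synthemeThrough i (l i))).card =
        (Finset.univ.filter fun i => k i = l i).card := by
  rw [← Finset.card_image_of_injective (Finset.univ.filter fun i => k i = l i)
    fun i j hij => ((synthemeThrough_inj i (k i) j (k j)).1 hij).1]
  congr 1
  ext S
  simp only [Finset.mem_inter, Finset.mem_image, Finset.mem_univ, true_and, Finset.mem_filter]
  constructor
  · rintro ⟨⟨i, rfl⟩, j, hj⟩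
    obtain ⟨rfl, h⟩ := (synthemeThrough_inj ..).1 hj
    exact ⟨j, h.symm, rfl⟩
  · rintro ⟨i, hi, rfl⟩
    exact ⟨⟨i, rfl⟩, i, hi ▸ rfl⟩

theorem IsTotalIndex.eq_or_card_agree_eq_one : ∀ k, IsTotalIndex k → ∀ l, IsTotalIndex l →
    k = l ∨ (Finset.univ.filter fun i => k i = l i).card = 1 := by
  decide +kernel

/-- Any two distinct totals have exactly one syntheme in common. -/
theorem distinct_totals_share_one_syntheme (T₁ T₂ : Finset (Finset (Finset (Fin 6))))
    (h₁ : IsTotalFamily T₁) (h₂ : IsTotalFamily T₂) (hne : T₁ ≠ T₂) :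
    (T₁ ∩ T₂).card = 1 := by
  obtain ⟨k, hk, rfl⟩ := h₁.exists_index
  obtain ⟨l, hl, rfl⟩ := h₂.exists_index
  rw [card_inter_image_synthemeThrough]
  exact (hk.eq_or_card_agree_eq_one _ l hl).resolve_left fun h => hne (h ▸ rfl)
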